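/- arXiv:2602.20894 — 2 statements merged into one kernel-verified Lean document; each statement's English description precedes it below -/
import Mathlib

section
/- The following are equivalent: (ii) there exists a Jacobi matrix J_n of order n whose characteristic polynomial equals ∏_{j=1}^n (x − x_j) and whose leading principal m × m submatrix J_m has characteristic polynomial ∏_{k=1}^m (x − y_k); (iii) there exist real numbers ω_1,…,ω_n with ω_j > 0 for all j such that ∑_{j=1}^n ω_j P_m(x_j) x_j^k = 0 for every k = 0,…,m−1. -/
/-- `Pm m y` is the monic polynomial `P_m(t) = ∏_{k=1}^m (t - y_k)` (1-based indexing). -/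
noncomputable def Pm (m : ℕ) (y : ℕ → ℝ) (t : ℝ) : ℝ := ∏ k ∈ Finset.Icc 1 m, (t - y k)

/-- A Jacobi matrix of order `n`: real entries, first superdiagonal identically `1`,
first subdiagonal strictly positive, and zero outside the three central diagonals
(the diagonal entries are arbitrary reals). -/
def IsJacobiMatrix {n : ℕ} (A : Matrix (Fin n) (Fin n) ℝ) : Prop :=
  (∀ p q : Fin n, (q : ℕ) = (p : ℕ) + 1 → A p q = 1) ∧
  (∀ p q : Fin n, (p : ℕ) = (q : ℕ) + 1 → 0 < A p q) ∧
  (∀ p q : Fin n, (p : ℕ) + 1 < (q : ℕ) ∨ (q : ℕ) + 1 < (p : ℕ) → A p q = 0)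

section

open Polynomial

/-- A sequence of polynomials generated by a monic three-term recurrence. -/
structure IsThreeTerm (p : ℕ → ℝ[X]) (β γ : ℕ → ℝ) : Prop where
  zero : p 0 = 1
  one : p 1 = X - C (β 0)
  step : ∀ k, p (k + 2) = (X - C (β (k + 1))) * p (k + 1) - C (γ (k + 1)) * p k

/-- Expansion of a tridiagonal determinant along its last row and column. -/
theorem det_tridiagonal_succ_succ {R : Type*} [CommRing R] (f : ℕ → ℕ → R)
    (hf : ∀ i j, i + 1 < j ∨ j + 1 < i → f i j = 0) (N : ℕ) :
    (Matrix.of fun i j : Fin (N + 2) => f i j).det =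
      f (N + 1) (N + 1) * (Matrix.of fun i j : Fin (N + 1) => f i j).det -
        f (N + 1) N * f N (N + 1) * (Matrix.of fun i j : Fin N => f i j).det := by
  rw [Matrix.det_succ_row _ (Fin.last (N + 1)), Fin.sum_univ_castSucc, Fin.sum_univ_castSucc,
    Finset.sum_eq_zero]
  · have hminor : ((Matrix.of fun i j : Fin (N + 2) => f i j).submatrix
        (Fin.last (N + 1)).succAbove (Fin.last N).castSucc.succAbove).det =
        f N (N + 1) * (Matrix.of fun i j : Fin N => f i j).det := by
      rw [Matrix.det_succ_column _ (Fin.last N), Fin.sum_univ_castSucc, Finset.sum_eq_zero]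
      · have h1 : (Fin.last N).castSucc.succAbove (Fin.last N) = Fin.last (N + 1) := by
          simp [Fin.succAbove]
        have h3 : (((Matrix.of fun i j : Fin (N + 2) => f i j).submatrix
            (Fin.last (N + 1)).succAbove (Fin.last N).castSucc.succAbove).submatrix
            (Fin.last N).succAbove (Fin.last N).succAbove) =
            Matrix.of fun i j : Fin N => f i j := by
          ext i j
          simp
        rw [h3]
        simp [h1, ← two_mul, pow_mul]
      · intro i _
        have h1 : (Fin.last N).castSucc.succAbove (Fin.last N) = Fin.last (N + 1) := by
          simp [Fin.succAbove]
        have := i.2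
        simp only [Matrix.submatrix_apply, Matrix.of_apply, h1]
        rw [hf]
        · simp
        · left
          simp
    have h4 : ((Matrix.of fun i j : Fin (N + 2) => f i j).submatrix
        (Fin.last (N + 1)).succAbove (Fin.last (N + 1)).succAbove) =
        Matrix.of fun i j : Fin (N + 1) => f i j := by
      ext i j
      simp
    rw [hminor, h4]
    have e1 : (-1 : R) ^ (N + 1 + N) = -1 := by
      rw [show N + 1 + N = 2 * N + 1 by ring, pow_succ, pow_mul]; simp
    have e2 : (-1 : R) ^ (N + 1 + (N + 1)) = 1 := by
      rw [← two_mul, pow_mul]; simp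
    simp only [Matrix.of_apply, Fin.val_last, Fin.val_castSucc, e1, e2]
    ring
  · intro i _
    have := i.2
    rw [Matrix.of_apply, hf]
    · simp
    · right
      simp

/-- The characteristic polynomials of the leading blocks of a tridiagonal matrix with unit
superdiagonal obey the three-term recurrence. -/
theorem IsThreeTerm.charpoly_eq {p : ℕ → ℝ[X]} {β γ : ℕ → ℝ} (hp : IsThreeTerm p β γ)
    {a : ℕ → ℕ → ℝ} (hdiag : ∀ i, a i i = β i) (hsup : ∀ i, a i (i + 1) = 1)
    (hsub : ∀ i, a (i + 1) i = γ (i + 1)) (ha : ∀ i j, i + 1 < j ∨ j + 1 < i → a i j = 0)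
    (N : ℕ) : (Matrix.of fun i j : Fin N => a i j).charpoly = p N := by
  let f : ℕ → ℕ → ℝ[X] := fun i j => (if i = j then X else 0) - C (a i j)
  have hcf : ∀ N : ℕ, (Matrix.of fun i j : Fin N => a i j).charpoly =
      (Matrix.of fun i j : Fin N => f i j).det := by
    intro N
    rw [Matrix.charpoly]
    congr 1
    ext1 i j
    simp [f, Matrix.charmatrix_apply, Matrix.diagonal_apply, Fin.ext_iff]
  have hf : ∀ i j, i + 1 < j ∨ j + 1 < i → f i j = 0 := by
    intro i j h
    have : i ≠ j := by omega
    simp [f, this, ha i j h]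
  induction N using Nat.twoStepInduction with
  | zero => simp [hp.zero, Matrix.charpoly]
  | one => rw [hcf, Matrix.det_fin_one, hp.one]; simp [f, hdiag]
  | more N h0 h1 =>
    rw [hcf, det_tridiagonal_succ_succ f hf, ← hcf, ← hcf, h0, h1, hp.step]
    simp [f, hdiag, hsup, hsub]

/-- Entries of the infinite tridiagonal matrix with unit superdiagonal, diagonal `β` and
subdiagonal `γ 1, γ 2, …`. -/
def tridiagonalEntry (β γ : ℕ → ℝ) (i j : ℕ) : ℝ :=
  if i = j then β i else if j = i + 1 then 1 else if i = j + 1 then γ i else 0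

theorem tridiagonalEntry_eq_zero (β γ : ℕ → ℝ) {i j : ℕ} (h : i + 1 < j ∨ j + 1 < i) :
    tridiagonalEntry β γ i j = 0 := by
  have h1 : i ≠ j := by omega
  have h2 : j ≠ i + 1 := by omega
  have h3 : i ≠ j + 1 := by omega
  simp [tridiagonalEntry, h1, h2, h3]

theorem tridiagonalEntry_succ (β γ : ℕ → ℝ) (i : ℕ) :
    tridiagonalEntry β γ (i + 1) i = γ (i + 1) := by
  rw [tridiagonalEntry, if_neg (by omega), if_neg (by omega), if_pos rfl]

theorem IsThreeTerm.charpoly_tridiagonalEntry {p : ℕ → ℝ[X]} {β γ : ℕ → ℝ}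
    (hp : IsThreeTerm p β γ) (N : ℕ) :
    (Matrix.of fun i j : Fin N => tridiagonalEntry β γ i j).charpoly = p N :=
  hp.charpoly_eq (by simp [tridiagonalEntry]) (by simp [tridiagonalEntry])
    (tridiagonalEntry_succ β γ) (fun _ _ => tridiagonalEntry_eq_zero β γ) N

theorem IsThreeTerm.monic_natDegree {p : ℕ → ℝ[X]} {β γ : ℕ → ℝ} (hp : IsThreeTerm p β γ)
    (k : ℕ) : (p k).Monic ∧ (p k).natDegree = k := by
  rw [← hp.charpoly_tridiagonalEntry]
  exact ⟨Matrix.charpoly_monic _, by simp [Matrix.charpoly_natDegree_eq_dim]⟩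

/-- The monic polynomials generated by the recurrence coefficients `β` and `γ`. -/
noncomputable def threeTerm (β γ : ℕ → ℝ) : ℕ → ℝ[X]
  | 0 => 1
  | 1 => X - C (β 0)
  | k + 2 => (X - C (β (k + 1))) * threeTerm β γ (k + 1) - C (γ (k + 1)) * threeTerm β γ k

theorem threeTerm_isThreeTerm (β γ : ℕ → ℝ) : IsThreeTerm (threeTerm β γ) β γ where
  zero := by rw [threeTerm]
  one := by rw [threeTerm]
  step k := by rw [threeTerm]

/-- The leading characteristic polynomials of a Jacobi matrix obey a three-term recurrence with
positive coefficients. -/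
theorem IsJacobiMatrix.exists_isThreeTerm {n : ℕ} {A : Matrix (Fin n) (Fin n) ℝ}
    (hA : IsJacobiMatrix A) :
    ∃ (p : ℕ → ℝ[X]) (β γ : ℕ → ℝ), IsThreeTerm p β γ ∧ (∀ k, 0 < γ (k + 1)) ∧
      ∀ (k : ℕ) (hk : k ≤ n), (A.submatrix (Fin.castLE hk) (Fin.castLE hk)).charpoly = p k := by
  obtain ⟨hsup, hsub, hzero⟩ := hA
  let β : ℕ → ℝ := fun k => if h : k < n then A ⟨k, h⟩ ⟨k, h⟩ else 0
  let γ : ℕ → ℝ := fun k => if h : k < n then A ⟨k, h⟩ ⟨k - 1, by omega⟩ else 1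
  refine ⟨threeTerm β γ, β, γ, threeTerm_isThreeTerm β γ, fun k => ?_, fun k hk => ?_⟩
  · by_cases h : k + 1 < n
    · simpa [γ, h] using hsub ⟨k + 1, h⟩ ⟨k, by omega⟩ rfl
    · simp [γ, h]
  · rw [← (threeTerm_isThreeTerm β γ).charpoly_tridiagonalEntry k]
    congr 1
    ext i j
    have hi : (i : ℕ) < n := by omega
    have hj : (j : ℕ) < n := by omega
    rw [Matrix.submatrix_apply, Matrix.of_apply]
    rcases (show (i : ℕ) = j ∨ (j : ℕ) = i + 1 ∨ (i : ℕ) = j + 1 ∨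
      ((i : ℕ) + 1 < j ∨ (j : ℕ) + 1 < i) by omega) with h | h | h | h
    · obtain rfl := Fin.ext h
      simp only [tridiagonalEntry, if_true, β, dif_pos hi]
      rfl
    · rw [hsup _ _ (by simpa using h)]
      simp [tridiagonalEntry, h]
    · have hj1 : (j : ℕ) + 1 < n := by omega
      have e : Fin.castLE hk i = ⟨j + 1, hj1⟩ := Fin.ext h
      rw [e, h, tridiagonalEntry_succ]
      simp only [γ, dif_pos hj1]
      rfl
    · rw [tridiagonalEntry_eq_zero _ _ h]
      exact hzero _ _ h

/-- The Christoffel–Darboux identity. -/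
theorem IsThreeTerm.christoffel_darboux {p : ℕ → ℝ[X]} {β γ : ℕ → ℝ} (hp : IsThreeTerm p β γ)
    (hγ : ∀ k, 0 < γ (k + 1)) (s t : ℝ) (N : ℕ) :
    (s - t) * ∑ k ∈ Finset.range (N + 1),
        (p k).eval s * (p k).eval t / ∏ i ∈ Finset.range k, γ (i + 1) =
      ((p (N + 1)).eval s * (p N).eval t - (p N).eval s * (p (N + 1)).eval t) /
        ∏ i ∈ Finset.range N, γ (i + 1) := by
  induction N with
  | zero => simp [hp.zero, hp.one]
  | succ N ih =>
    have h1 := (hγ N).ne'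
    have h2 : ∏ i ∈ Finset.range N, γ (i + 1) ≠ 0 :=
      Finset.prod_ne_zero_iff.2 fun i _ => (hγ i).ne'
    rw [Finset.sum_range_succ, mul_add, ih, hp.step, Finset.prod_range_succ]
    simp only [eval_sub, eval_mul, eval_X, eval_C]
    field_simp
    ring

/-- Orthogonality to `p 0, …, p (m - 1)` implies orthogonality to `1, …, X ^ (m - 1)`. -/
theorem IsThreeTerm.map_mul_X_pow_eq_zero {p : ℕ → ℝ[X]} {β γ : ℕ → ℝ}
    (hp : IsThreeTerm p β γ) (L : ℝ[X] →ₗ[ℝ] ℝ) (q : ℝ[X]) (m : ℕ)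
    (h : ∀ l < m, L (q * p l) = 0) (i : ℕ) (hi : i < m) : L (q * X ^ i) = 0 := by
  suffices H : ∀ i l, l + i < m → L (q * X ^ i * p l) = 0 by
    simpa [hp.zero] using H i 0 (by omega)
  intro i
  induction i with
  | zero => intro l hl; simpa using h l hl
  | succ i ih =>
    intro l hl
    rcases l with _ | l
    · have e : q * X ^ (i + 1) * p 0 = q * X ^ i * p 1 + β 0 • (q * X ^ i * p 0) := by
        rw [hp.zero, hp.one, smul_eq_C_mul]; ring
      rw [e, map_add, map_smul, ih 1 (by omega), ih 0 (by omega)]; simp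
    · have e : q * X ^ (i + 1) * p (l + 1) = q * X ^ i * p (l + 2) +
          β (l + 1) • (q * X ^ i * p (l + 1)) + γ (l + 1) • (q * X ^ i * p l) := by
        rw [hp.step, smul_eq_C_mul, smul_eq_C_mul]; ring
      rw [e, map_add, map_add, map_smul, map_smul, ih (l + 2) (by omega), ih (l + 1) (by omega),
        ih l (by omega)]
      simp

/-- The functional integrating a polynomial against the discrete measure with weights `ω` at the
nodes `ξ`. -/
noncomputable def discreteFunctional {n : ℕ} (ω ξ : Fin n → ℝ) : ℝ[X] →ₗ[ℝ] ℝ :=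
  ∑ j, ω j • leval (ξ j)

theorem discreteFunctional_apply {n : ℕ} (ω ξ : Fin n → ℝ) (q : ℝ[X]) :
    discreteFunctional ω ξ q = ∑ j, ω j * q.eval (ξ j) := by
  simp [discreteFunctional, LinearMap.sum_apply]

/-- Gauss quadrature: a three-term recurrence with positive coefficients is orthogonal with
respect to a positive measure on the zeros of its `n`-th member. -/
theorem IsThreeTerm.exists_weights {p : ℕ → ℝ[X]} {β γ : ℕ → ℝ} (hp : IsThreeTerm p β γ)
    (hγ : ∀ k, 0 < γ (k + 1)) {n : ℕ} {ξ : Fin n → ℝ} (hξ : Function.Injective ξ)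
    (hroot : ∀ j, (p n).eval (ξ j) = 0) :
    ∃ ω : Fin n → ℝ, (∀ j, 0 < ω j) ∧
      ∀ k < n, ∀ l < n, k ≠ l → discreteFunctional ω ξ (p k * p l) = 0 := by
  rcases n with _ | n
  · exact ⟨0, fun j => j.elim0, by omega⟩
  let h : ℕ → ℝ := fun k => ∏ i ∈ Finset.range k, γ (i + 1)
  have hh : ∀ k, 0 < h k := fun k => Finset.prod_pos fun i _ => hγ i
  let S : Fin (n + 1) → ℝ := fun j => ∑ k : Fin (n + 1), (p k).eval (ξ j) ^ 2 / h k
  have hS : ∀ j, 0 < S j := by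
    intro j
    refine Finset.sum_pos' (fun k _ => div_nonneg (sq_nonneg _) (hh k).le) ⟨0, Finset.mem_univ _, ?_⟩
    simp [hp.zero, hh]
  refine ⟨fun j => (S j)⁻¹, fun j => inv_pos.2 (hS j), ?_⟩
  let V : Matrix (Fin (n + 1)) (Fin (n + 1)) ℝ := Matrix.of fun j k => (p k).eval (ξ j)
  let U : Matrix (Fin (n + 1)) (Fin (n + 1)) ℝ :=
    Matrix.of fun k j => (p k).eval (ξ j) / h k * (S j)⁻¹
  have hVU : V * U = 1 := by
    ext i j
    have e : (V * U) i j =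
        (∑ k : Fin (n + 1), (p k).eval (ξ i) * (p k).eval (ξ j) / h k) * (S j)⁻¹ := by
      rw [Matrix.mul_apply, Finset.sum_mul]
      exact Finset.sum_congr rfl fun k _ => by simp only [V, U, Matrix.of_apply]; ring
    rw [e]
    by_cases hij : i = j
    · subst hij
      simp only [Matrix.one_apply_eq, ← sq]
      exact mul_inv_cancel₀ (hS i).ne'
    · have cd := hp.christoffel_darboux hγ (ξ i) (ξ j) n
      rw [hroot, hroot, zero_mul, mul_zero, sub_zero, zero_div, mul_eq_zero,
        or_iff_right (sub_ne_zero.2 (hξ.ne hij)), Finset.sum_range] at cd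
      rw [Matrix.one_apply_ne hij, cd, zero_mul]
  have hUV := mul_eq_one_comm.1 hVU
  intro k hk l hl hkl
  have := congrFun (congrFun hUV ⟨k, hk⟩) ⟨l, hl⟩
  rw [Matrix.one_apply_ne (by simpa using hkl), Matrix.mul_apply] at this
  simp only [V, U, Matrix.of_apply] at this
  rw [discreteFunctional_apply, ← mul_zero (h k), ← this, Finset.mul_sum]
  refine Finset.sum_congr rfl fun j _ => ?_
  have := (hh k).ne'
  rw [eval_mul]
  field_simp

theorem discreteFunctional_mul_self_pos {n : ℕ} {ω ξ : Fin n → ℝ} (hω : ∀ j, 0 < ω j)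
    (hξ : Function.Injective ξ) {q : ℝ[X]} (hq : q ≠ 0) (hdeg : q.degree < n) :
    0 < discreteFunctional ω ξ (q * q) := by
  rw [discreteFunctional_apply]
  have : ∃ j, q.eval (ξ j) ≠ 0 := by
    by_contra! hz
    refine hq (eq_zero_of_degree_lt_of_eval_index_eq_zero Finset.univ (v := ξ) hξ.injOn ?_
      fun j _ => hz j)
    simpa using hdeg
  obtain ⟨j, hj⟩ := this
  refine Finset.sum_pos' (fun i _ => ?_) ⟨j, Finset.mem_univ _, ?_⟩
  · rw [eval_mul]
    exact mul_nonneg (hω i).le (mul_self_nonneg _)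
  · rw [eval_mul]
    exact mul_pos (hω j) (mul_self_pos.2 hj)

/-- A monic polynomial of degree `m ≤ n` orthogonal to all lower powers is unique. -/
theorem Polynomial.Monic.eq_of_discreteFunctional {n m : ℕ} {ω ξ : Fin n → ℝ}
    (hω : ∀ j, 0 < ω j) (hξ : Function.Injective ξ) (hmn : m ≤ n) {q r : ℝ[X]} (hq : q.Monic)
    (hr : r.Monic) (hqm : q.natDegree = m) (hrm : r.natDegree = m)
    (hqo : ∀ i < m, discreteFunctional ω ξ (q * X ^ i) = 0)
    (hro : ∀ i < m, discreteFunctional ω ξ (r * X ^ i) = 0) : q = r := by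
  by_contra hne
  have hdeg : (q - r).degree < m := by
    have := degree_sub_lt_left (p := q) (q := r)
      (by rw [degree_eq_natDegree hq.ne_zero, degree_eq_natDegree hr.ne_zero, hqm, hrm])
      hq.ne_zero (by rw [hq.leadingCoeff, hr.leadingCoeff])
    rwa [degree_eq_natDegree hq.ne_zero, hqm] at this
  have hpos := discreteFunctional_mul_self_pos hω hξ (sub_ne_zero.2 hne)
    (hdeg.trans_le (by exact_mod_cast hmn))
  have hnat : (q - r).natDegree < m := (natDegree_lt_iff_degree_lt (sub_ne_zero.2 hne)).2 hdeg
  have : discreteFunctional ω ξ ((q - r) * (q - r)) = 0 := by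
    nth_rewrite 2 [(q - r).as_sum_range' m hnat]
    rw [Finset.mul_sum, map_sum]
    refine Finset.sum_eq_zero fun i hi => ?_
    have hi := Finset.mem_range.1 hi
    rw [← C_mul_X_pow_eq_monomial, ← smul_eq_C_mul, mul_smul_comm, map_smul, sub_mul, map_sub,
      hqo i hi, hro i hi]
    simp
  exact hpos.ne' this

/-- The Stieltjes procedure generating the monic orthogonal polynomials of `L`. -/
noncomputable def stieltjes (L : ℝ[X] →ₗ[ℝ] ℝ) : ℕ → ℝ[X]
  | 0 => 1
  | 1 => X - C (L X / L 1)
  | k + 2 =>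
    (X - C (L (X * stieltjes L (k + 1) * stieltjes L (k + 1)) /
      L (stieltjes L (k + 1) * stieltjes L (k + 1)))) * stieltjes L (k + 1) -
    C (L (stieltjes L (k + 1) * stieltjes L (k + 1)) / L (stieltjes L k * stieltjes L k)) *
      stieltjes L k

theorem stieltjes_isThreeTerm (L : ℝ[X] →ₗ[ℝ] ℝ) :
    IsThreeTerm (stieltjes L)
      (fun k => L (X * stieltjes L k * stieltjes L k) / L (stieltjes L k * stieltjes L k))
      (fun k => L (stieltjes L k * stieltjes L k) /
        L (stieltjes L (k - 1) * stieltjes L (k - 1))) where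
  zero := by rw [stieltjes]
  one := by simp [stieltjes]
  step k := by rw [stieltjes]; rfl

theorem stieltjes_orthogonal (L : ℝ[X] →ₗ[ℝ] ℝ) (n : ℕ)
    (hL : ∀ k < n, L (stieltjes L k * stieltjes L k) ≠ 0) (k : ℕ) (hk : k ≤ n) (i : ℕ)
    (hi : i < k) : L (stieltjes L k * stieltjes L i) = 0 := by
  have hp := stieltjes_isThreeTerm L
  set p := stieltjes L
  induction k using Nat.strong_induction_on generalizing i with
  | _ k ih =>
  rcases k with _ | _ | k
  · omega
  · obtain rfl : i = 0 := by omega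
    have h0 := hL 0 (by omega)
    have e : p 1 * p 0 = X * p 0 * p 0 - (L (X * p 0 * p 0) / L (p 0 * p 0)) • (p 0 * p 0) := by
      rw [hp.one, hp.zero, smul_eq_C_mul]; ring
    rw [zero_add, e, map_sub, map_smul, smul_eq_mul]
    field_simp
    ring
  · have h0 := hL k (by omega)
    have h1 := hL (k + 1) (by omega)
    have hk1 : L (p (k + 1) * p k) = 0 := ih (k + 1) (by omega) (by omega) k (by omega)
    have e : p (k + 2) * p i = X * p (k + 1) * p i -
        (L (X * p (k + 1) * p (k + 1)) / L (p (k + 1) * p (k + 1))) • (p (k + 1) * p i) -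
        (L (p (k + 1) * p (k + 1)) / L (p k * p k)) • (p k * p i) := by
      rw [hp.step, smul_eq_C_mul, smul_eq_C_mul]; simp only [Nat.add_sub_cancel]; ring
    rw [add_assoc, e, map_sub, map_sub, map_smul, map_smul, smul_eq_mul, smul_eq_mul]
    rcases (show i = k + 1 ∨ i ≤ k by omega) with rfl | hik
    · rw [mul_comm (p k) (p (k + 1)), hk1]
      field_simp
      ring
    · have hki : L (p (k + 1) * p i) = 0 := ih (k + 1) (by omega) (by omega) i (by omega)
      have hX : L (X * p (k + 1) * p i) = L (p (k + 1) * p (i + 1)) := by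
        rcases i with _ | i
        · have e' : X * p (k + 1) * p 0 = p (k + 1) * p 1 +
              (L (X * p 0 * p 0) / L (p 0 * p 0)) • (p (k + 1) * p 0) := by
            rw [hp.one, hp.zero, smul_eq_C_mul]; ring
          rw [e', map_add, map_smul, hki]; simp
        · have e' : X * p (k + 1) * p (i + 1) = p (k + 1) * p (i + 2) +
              (L (X * p (i + 1) * p (i + 1)) / L (p (i + 1) * p (i + 1))) •
                (p (k + 1) * p (i + 1)) +
              (L (p (i + 1) * p (i + 1)) / L (p i * p i)) • (p (k + 1) * p i) := by
            rw [hp.step, smul_eq_C_mul, smul_eq_C_mul]; simp only [Nat.add_sub_cancel]; ring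
          rw [e', map_add, map_add, map_smul, map_smul, hki,
            ih (k + 1) (by omega) (by omega) i (by omega)]
          simp
      rw [hX, hki]
      rcases (show i = k ∨ i < k by omega) with rfl | hlt
      · field_simp
        ring
      · rw [ih k (by omega) (by omega) i hlt,
          ih (k + 1) (by omega) (by omega) (i + 1) (by omega)]
        simp

end

/-- equivalence of
(ii) existence of a Jacobi matrix `J_n` with characteristic polynomial `∏_{j=1}^n (X - x_j)`
whose leading principal `m × m` submatrix has characteristic polynomial `∏_{k=1}^m (X - y_k)`;
(iii) existence of strictly positive weights `ω_1,…,ω_n` with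
`∑_j ω_j P_m(x_j) x_j^k = 0` for every `k = 0,…,m-1`. -/
theorem stmt_8 (m n : ℕ) (hm : 1 ≤ m) (hmn : m < n)
    (x y : ℕ → ℝ)
    (hx : ∀ j j', 1 ≤ j → j < j' → j' ≤ n → x j < x j')
    (hy : ∀ k k', 1 ≤ k → k < k' → k' ≤ m → y k < y k')
    (hxy : ∀ j k, 1 ≤ j → j ≤ n → 1 ≤ k → k ≤ m → x j ≠ y k) :
    (∃ A : Matrix (Fin n) (Fin n) ℝ, IsJacobiMatrix A ∧
      A.charpoly = ∏ j ∈ Finset.Icc 1 n, (Polynomial.X - Polynomial.C (x j)) ∧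
      (A.submatrix (Fin.castLE hmn.le) (Fin.castLE hmn.le)).charpoly
        = ∏ k ∈ Finset.Icc 1 m, (Polynomial.X - Polynomial.C (y k)))
    ↔ (∃ ω : Fin n → ℝ, (∀ j, 0 < ω j) ∧
        ∀ k, k < m →
          ∑ j : Fin n, ω j * Pm m y (x ((j : ℕ) + 1)) * x ((j : ℕ) + 1) ^ k = 0) := by
  let ξ : Fin n → ℝ := fun j => x ((j : ℕ) + 1)
  have hξ : Function.Injective ξ := by
    intro i j hij
    by_contra hne
    rcases lt_or_gt_of_ne (fun h => hne (Fin.ext h) : (i : ℕ) ≠ j) with h | h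
    · exact (hx (i + 1) (j + 1) (by omega) (by omega) (by omega)).ne hij
    · exact (hx (j + 1) (i + 1) (by omega) (by omega) (by omega)).ne' hij
  have hroot : ∀ j, (∏ j ∈ Finset.Icc 1 n, (Polynomial.X - Polynomial.C (x j))).eval (ξ j) = 0 := by
    intro j
    rw [Polynomial.eval_prod]
    exact Finset.prod_eq_zero (i := (j : ℕ) + 1) (Finset.mem_Icc.2 ⟨by omega, by omega⟩)
      (by simp [ξ])
  have hPm : ∀ t, (∏ k ∈ Finset.Icc 1 m, (Polynomial.X - Polynomial.C (y k))).eval t = Pm m y t := by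
    intro t
    simp [Polynomial.eval_prod, Pm]
  have hsum : ∀ (ω : Fin n → ℝ) (k : ℕ),
      discreteFunctional ω ξ ((∏ k ∈ Finset.Icc 1 m, (Polynomial.X - Polynomial.C (y k))) *
        Polynomial.X ^ k) =
      ∑ j : Fin n, ω j * Pm m y (x ((j : ℕ) + 1)) * x ((j : ℕ) + 1) ^ k := by
    intro ω k
    rw [discreteFunctional_apply]
    exact Finset.sum_congr rfl fun j _ => by simp [hPm, ξ, mul_assoc]
  constructor
  · rintro ⟨A, hA, hAn, hAm⟩
    obtain ⟨p, β, γ, hp, hγ, hchar⟩ := hA.exists_isThreeTerm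
    have hpn : p n = ∏ j ∈ Finset.Icc 1 n, (Polynomial.X - Polynomial.C (x j)) := by
      rw [← hAn, ← hchar n le_rfl]
      rfl
    have hpm := (hchar m hmn.le).symm.trans hAm
    obtain ⟨ω, hω, horth⟩ := hp.exists_weights hγ hξ (by rw [hpn]; exact hroot)
    refine ⟨ω, hω, fun k hk => ?_⟩
    rw [← hsum, ← hpm]
    exact hp.map_mul_X_pow_eq_zero _ _ m
      (fun l hl => horth m hmn l (hl.trans hmn) hl.ne') k hk
  · rintro ⟨ω, hω, horth⟩
    let L := discreteFunctional ω ξ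
    have hp := stieltjes_isThreeTerm L
    have hpos : ∀ k < n, 0 < L (stieltjes L k * stieltjes L k) := by
      intro k hk
      obtain ⟨hmonic, hdeg⟩ := hp.monic_natDegree k
      refine discreteFunctional_mul_self_pos hω hξ hmonic.ne_zero ?_
      rw [Polynomial.degree_eq_natDegree hmonic.ne_zero, hdeg]
      exact_mod_cast hk
    have huniq : ∀ k ≤ n, ∀ z : ℕ → ℝ,
        (∀ i < k, L ((∏ j ∈ Finset.Icc 1 k, (Polynomial.X - Polynomial.C (z j))) *
          Polynomial.X ^ i) = 0) →
        stieltjes L k = ∏ j ∈ Finset.Icc 1 k, (Polynomial.X - Polynomial.C (z j)) := by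
      intro k hk z hz
      obtain ⟨hmonic, hdeg⟩ := hp.monic_natDegree k
      refine hmonic.eq_of_discreteFunctional hω hξ hk
        (Polynomial.monic_prod_of_monic _ _ fun j _ => Polynomial.monic_X_sub_C _) hdeg ?_ ?_ hz
      · rw [Polynomial.natDegree_prod_of_monic _ _ fun j _ => Polynomial.monic_X_sub_C _]
        simp
      · exact hp.map_mul_X_pow_eq_zero _ _ k
          (stieltjes_orthogonal L n (fun k hk => (hpos k hk).ne') k hk)
    let a := tridiagonalEntry
      (fun k => L (Polynomial.X * stieltjes L k * stieltjes L k) /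
        L (stieltjes L k * stieltjes L k))
      (fun k => L (stieltjes L k * stieltjes L k) /
        L (stieltjes L (k - 1) * stieltjes L (k - 1)))
    have hchar : ∀ N : ℕ, (Matrix.of fun i j : Fin N => a i j).charpoly = stieltjes L N :=
      hp.charpoly_tridiagonalEntry
    refine ⟨Matrix.of fun i j : Fin n => a i j, ⟨?_, ?_, ?_⟩, ?_, ?_⟩
    · intro i j h
      simp [a, tridiagonalEntry, h]
    · intro i j h
      have h1 : 0 < L (stieltjes L i * stieltjes L i) := hpos i i.2
      have h2 : 0 < L (stieltjes L j * stieltjes L j) := hpos j j.2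
      rw [h] at h1
      rw [Matrix.of_apply, h]
      simp only [a, tridiagonalEntry_succ, Nat.add_sub_cancel]
      exact div_pos h1 h2
    · intro i j h
      rw [Matrix.of_apply]
      exact tridiagonalEntry_eq_zero _ _ h
    · rw [hchar]
      refine huniq n le_rfl x fun i _ => ?_
      rw [discreteFunctional_apply]
      exact Finset.sum_eq_zero fun j _ => by rw [Polynomial.eval_mul, hroot]; simp
    · refine (hchar m).trans (huniq m hmn.le y fun i hi => ?_)
      exact (hsum ω i).trans (horth i hi)
end

section
/- There exists a Jacobi matrix J_n of order n whose characteristic polynomial equals ∏_{j=1}^n (x − x_j) and whose leading principal m × m submatrix J_m has characteristic polynomial ∏_{k=1}^m (x − y_k) (equivalently, the spectrum of J_n is {x_1,…,x_n} and the spectrum of J_m is {y_1,…,y_m}) if and only if {y_k}_{k=1}^m strictly interlaces {x_j}_{j=1}^n. -/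
/-- `{y_k}_{k=1}^m` strictly interlaces `{x_j}_{j=1}^n`: there are integers
`0 = i_0 < i_1 < ⋯ < i_m < i_{m+1} = n` with `x_{i_k} < y_k < x_{i_k + 1}` for `k = 1,…,m`
(1-based indexing of the sequences `x`, `y`). -/
def StrictlyInterlacesR (n m : ℕ) (x y : ℕ → ℝ) : Prop :=
  ∃ i : ℕ → ℕ, i 0 = 0 ∧ i (m + 1) = n ∧ (∀ r, r ≤ m → i r < i (r + 1)) ∧
    ∀ k, 1 ≤ k → k ≤ m → x (i k) < y k ∧ y k < x (i k + 1)

section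

open Polynomial Finset

/-- The column of `Aᵏ` indexed by `0` is supported on the indices `≤ k`. -/
theorem IsJacobiMatrix.pow_apply_zero_right {n : ℕ} {A : Matrix (Fin n) (Fin n) ℝ}
    (hA : IsJacobiMatrix A) {o : Fin n} (ho : (o : ℕ) = 0) (k : ℕ) (q : Fin n) (hq : k < q) :
    (A ^ k) q o = 0 := by
  induction k generalizing q with
  | zero =>
    rw [pow_zero, Matrix.one_apply_ne]
    rintro rfl
    omega
  | succ k ih =>
    rw [pow_succ', Matrix.mul_apply]
    refine sum_eq_zero fun r _ => ?_
    by_cases hr : k < r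
    · rw [ih r hr, mul_zero]
    · rw [hA.2.2 q r (Or.inr (by omega)), zero_mul]

/-- The row of `Aᵏ` indexed by `0` is supported on the indices `≤ k`. -/
theorem IsJacobiMatrix.pow_apply_zero_left {n : ℕ} {A : Matrix (Fin n) (Fin n) ℝ}
    (hA : IsJacobiMatrix A) {o : Fin n} (ho : (o : ℕ) = 0) (k : ℕ) (q : Fin n) (hq : k < q) :
    (A ^ k) o q = 0 := by
  induction k generalizing q with
  | zero =>
    rw [pow_zero, Matrix.one_apply_ne]
    rintro rfl
    omega
  | succ k ih =>
    rw [pow_succ, Matrix.mul_apply]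
    refine sum_eq_zero fun r _ => ?_
    by_cases hr : k < r
    · rw [ih r hr, zero_mul]
    · rw [hA.2.2 r q (Or.inl (by omega)), mul_zero]

/-- Up to the power `m`, the first row of the powers of `A` agrees on the first `m` entries with
that of the powers of the leading principal `m × m` submatrix. -/
theorem IsJacobiMatrix.pow_submatrix_castLE {n m : ℕ} {A : Matrix (Fin n) (Fin n) ℝ}
    (hA : IsJacobiMatrix A) (hmn : m ≤ n) {o : Fin m} (ho : (o : ℕ) = 0) (k : ℕ) (hk : k ≤ m)
    (q : Fin m) :
    (A.submatrix (Fin.castLE hmn) (Fin.castLE hmn) ^ k) o q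
      = (A ^ k) (Fin.castLE hmn o) (Fin.castLE hmn q) := by
  induction k generalizing q with
  | zero => simp [Matrix.one_apply]
  | succ k ih =>
    rw [pow_succ, pow_succ, Matrix.mul_apply, Matrix.mul_apply]
    refine Fintype.sum_of_injective (Fin.castLE hmn) (Fin.castLE_injective hmn) _ _ ?_ ?_
    · intro r hr
      have hmr : m ≤ r := by
        by_contra h
        exact hr ⟨⟨r, by omega⟩, by ext; simp⟩
      rw [hA.pow_apply_zero_left (by simpa using ho) k r (by omega), zero_mul]
    · intro r
      rw [ih (by omega), Matrix.submatrix_apply]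

theorem IsJacobiMatrix.aeval_apply_zero_right {n m : ℕ} {A : Matrix (Fin n) (Fin n) ℝ}
    (hA : IsJacobiMatrix A) {o : Fin n} (ho : (o : ℕ) = 0) {f : ℝ[X]} (hf : f.natDegree < m)
    (q : Fin n) (hq : m ≤ q) : (aeval A f) q o = 0 := by
  rw [aeval_eq_sum_range' hf, Matrix.sum_apply]
  refine sum_eq_zero fun k hk => ?_
  rw [Matrix.smul_apply, hA.pow_apply_zero_right ho k q (by have := mem_range.1 hk; omega),
    smul_zero]

/-- The characteristic polynomial of the leading principal `m × m` submatrix, evaluated at `A`,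
has vanishing first `m` entries in its first row. -/
theorem IsJacobiMatrix.aeval_charpoly_submatrix {n m : ℕ} {A : Matrix (Fin n) (Fin n) ℝ}
    (hA : IsJacobiMatrix A) (hmn : m ≤ n) {o : Fin n} (ho : (o : ℕ) = 0) (q : Fin n)
    (hq : (q : ℕ) < m) :
    (aeval A (A.submatrix (Fin.castLE hmn) (Fin.castLE hmn)).charpoly) o q = 0 := by
  set B := A.submatrix (Fin.castLE hmn) (Fin.castLE hmn) with hB
  have h0 := congrFun (congrFun (Matrix.aeval_self_charpoly B) ⟨o, by omega⟩) ⟨q, hq⟩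
  rw [aeval_eq_sum_range, Matrix.sum_apply, Matrix.zero_apply] at h0
  rw [aeval_eq_sum_range, Matrix.sum_apply, ← h0]
  refine sum_congr rfl fun k hk => ?_
  rw [B.charpoly_natDegree_eq_dim, Fintype.card_fin, mem_range] at hk
  rw [Matrix.smul_apply, Matrix.smul_apply, hB,
    hA.pow_submatrix_castLE hmn (o := ⟨o, by omega⟩) ho k (by omega)]
  rfl

/-- A Jacobi matrix is symmetrized by a positive diagonal matrix. -/
theorem IsJacobiMatrix.exists_symmetrizer {n : ℕ} {A : Matrix (Fin n) (Fin n) ℝ}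
    (hA : IsJacobiMatrix A) :
    ∃ d : Fin n → ℝ, (∀ p, 0 < d p) ∧ ∀ p q, A p q * d q = d p * A q p := by
  let c : ℕ → ℝ := fun l => if h : l + 1 < n then A ⟨l + 1, h⟩ ⟨l, by omega⟩ else 1
  have hc : ∀ l, 0 < c l := fun l => by
    by_cases h : l + 1 < n
    · simp only [c, h, dif_pos]
      exact hA.2.1 _ _ rfl
    · simp [c, h]
  refine ⟨fun p => ∏ l ∈ range p, c l, fun p => prod_pos fun l _ => hc l, ?_⟩
  have key : ∀ p q : Fin n, (q : ℕ) = p + 1 →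
      A p q * ∏ l ∈ range q, c l = (∏ l ∈ range p, c l) * A q p := by
    intro p q h
    have hcp : c p = A q p := by
      have hq : (p : ℕ) + 1 < n := h ▸ q.2
      simp only [c, hq, dif_pos]
      congr 1
      ext
      simp [h]
    rw [hA.1 p q h, h, prod_range_succ, hcp, one_mul]
  intro p q
  rcases lt_trichotomy ((p : ℕ) + 1) q with h | h | h
  · simp [hA.2.2 p q (Or.inl h), hA.2.2 q p (Or.inr h)]
  · exact key p q h.symm
  · rcases lt_trichotomy ((q : ℕ) + 1) p with h' | h' | h'
    · simp [hA.2.2 p q (Or.inr h'), hA.2.2 q p (Or.inl h')]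
    · have := key q p h'.symm
      simp only at this ⊢
      linarith
    · have : p = q := by ext; omega
      subst this
      ring

theorem Matrix.aeval_mul_eq_mul_aeval_swap {n : ℕ} {A : Matrix (Fin n) (Fin n) ℝ} {d : Fin n → ℝ}
    (hd : ∀ p q, A p q * d q = d p * A q p) (f : ℝ[X]) (p q : Fin n) :
    aeval A f p q * d q = d p * aeval A f q p := by
  have hpow : ∀ (k : ℕ) (p q : Fin n), (A ^ k) p q * d q = d p * (A ^ k) q p := by
    intro k
    induction k with
    | zero =>
      intro p q
      by_cases h : p = q
      · subst h
        simp
      · simp [Matrix.one_apply_ne h, Matrix.one_apply_ne (Ne.symm h)]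
    | succ k ih =>
      intro p q
      rw [pow_succ, Matrix.mul_apply, ← pow_succ, pow_succ', Matrix.mul_apply, sum_mul, mul_sum]
      refine sum_congr rfl fun r _ => ?_
      rw [mul_assoc, hd, ← mul_assoc, ih]
      ring
  rw [aeval_eq_sum_range, Matrix.sum_apply, Matrix.sum_apply, sum_mul, mul_sum]
  refine sum_congr rfl fun k _ => ?_
  rw [Matrix.smul_apply, Matrix.smul_apply, smul_mul_assoc, hpow, mul_smul_comm]

/-- The spectral measure of a Jacobi matrix with simple spectrum at its first basis vector:
nonnegative weights on the eigenvalues, not all zero, for which the characteristic polynomial of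
the leading principal `m × m` submatrix is orthogonal to all polynomials of degree `< m`. -/
theorem IsJacobiMatrix.exists_weights {n m : ℕ} {A : Matrix (Fin n) (Fin n) ℝ}
    (hA : IsJacobiMatrix A) (hm : 0 < m) (hmn : m ≤ n) {ι : Type*} [DecidableEq ι]
    {s : Finset ι} {x : ι → ℝ} (hx : Set.InjOn x s)
    (hP : A.charpoly = ∏ j ∈ s, (X - C (x j))) :
    ∃ w : ι → ℝ, (∀ j ∈ s, 0 ≤ w j) ∧ 0 < ∑ j ∈ s, w j ∧
      ∀ f : ℝ[X], f.natDegree < m → ∑ j ∈ s, w j *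
        ((A.submatrix (Fin.castLE hmn) (Fin.castLE hmn)).charpoly.eval (x j) * f.eval (x j))
          = 0 := by
  have hn : 0 < n := by omega
  set o : Fin n := ⟨0, hn⟩ with ho
  obtain ⟨d, hdpos, hd⟩ := hA.exists_symmetrizer
  have hs : s.Nonempty := by
    rw [nonempty_iff_ne_empty]
    rintro rfl
    have h := A.charpoly_natDegree_eq_dim
    rw [hP, prod_empty, natDegree_one, Fintype.card_fin] at h
    omega
  have hzero : ∀ f : ℝ[X], (∀ j ∈ s, f.eval (x j) = 0) → aeval A f = 0 := by
    intro f hf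
    have hdvd : A.charpoly ∣ f := by
      rw [hP]
      refine Finset.prod_dvd_of_coprime ?_ fun j hj => dvd_iff_isRoot.2 (hf j hj)
      intro i hi j hj hij
      exact isCoprime_X_sub_C_of_isUnit_sub
        (sub_ne_zero.2 fun h => hij (hx hi hj h)).isUnit
    obtain ⟨g, rfl⟩ := hdvd
    rw [map_mul, Matrix.aeval_self_charpoly, zero_mul]
  have hsq : ∀ g : ℝ[X], 0 ≤ aeval A (g * g) o o := by
    intro g
    rw [map_mul, Matrix.mul_apply]
    refine sum_nonneg fun q _ => ?_
    have h := Matrix.aeval_mul_eq_mul_aeval_swap hd g o q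
    have h' : aeval A g q o = aeval A g o q * d q / d o := by
      rw [h, mul_div_cancel_left₀ _ (hdpos o).ne']
    rw [h', ← mul_div_assoc, ← mul_assoc]
    exact div_nonneg (mul_nonneg (mul_self_nonneg _) (hdpos q).le) (hdpos o).le
  have hquad : ∀ f : ℝ[X],
      aeval A f o o = ∑ j ∈ s, aeval A (Lagrange.basis s x j) o o * f.eval (x j) := by
    intro f
    have h := hzero (f - Lagrange.interpolate s x (fun j => f.eval (x j))) fun j hj => by
      rw [eval_sub, Lagrange.eval_interpolate_at_node _ hx hj, sub_self]
    rw [map_sub, sub_eq_zero] at h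
    rw [h, Lagrange.interpolate_apply, map_sum, Matrix.sum_apply]
    refine sum_congr rfl fun j _ => ?_
    rw [← smul_eq_C_mul, map_smul, Matrix.smul_apply, smul_eq_mul, mul_comm]
  refine ⟨fun j => aeval A (Lagrange.basis s x j) o o, ?_, ?_, ?_⟩
  · intro j hj
    have h := hzero (Lagrange.basis s x j - Lagrange.basis s x j * Lagrange.basis s x j)
      fun i hi => by
        rcases eq_or_ne j i with rfl | hij
        · simp [Lagrange.eval_basis_self hx hi]
        · simp [Lagrange.eval_basis_of_ne hij hi]
    rw [map_sub, sub_eq_zero] at h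
    exact (hsq _).trans_eq (congrFun (congrFun h.symm o) o)
  · rw [← Matrix.sum_apply, ← map_sum, Lagrange.sum_basis hx hs]
    simp
  · intro f hf
    have h := hquad ((A.submatrix (Fin.castLE hmn) (Fin.castLE hmn)).charpoly * f)
    simp only [eval_mul] at h
    rw [← h, map_mul, Matrix.mul_apply]
    refine sum_eq_zero fun q _ => ?_
    rcases lt_or_ge (q : ℕ) m with hq | hq
    · rw [hA.aeval_charpoly_submatrix hmn rfl q hq, zero_mul]
    · rw [hA.aeval_apply_zero_right rfl hf q hq, mul_zero]

/-- A set of zeros of `∏ (X - y k)` against which the weights are one-sided contradicts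
orthogonality to the polynomials of lower degree. -/
theorem not_forall_pos_of_orthogonal {ι κ : Type*} [DecidableEq κ] {s : Finset ι} {t u : Finset κ}
    {x w : ι → ℝ} {y : κ → ℝ} (hw : ∀ j ∈ s, 0 ≤ w j) (hw' : 0 < ∑ j ∈ s, w j)
    (hxy : ∀ j ∈ s, ∀ k ∈ t, x j ≠ y k) (hut : u ⊆ t) (hu : u.Nonempty)
    (horth : ∀ f : ℝ[X], f.natDegree < #t →
      ∑ j ∈ s, w j * ((∏ k ∈ t, (X - C (y k))).eval (x j) * f.eval (x j)) = 0) (c : ℝ)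
    (hpos : ∀ j ∈ s, 0 < c * ∏ k ∈ u, (x j - y k)) : False := by
  have h := horth (∏ k ∈ t \ u, (X - C (y k))) (by
    rw [natDegree_finsetProd_X_sub_C_eq_card]
    exact card_lt_card (sdiff_ssubset hut hu))
  have hpos' : ∀ j ∈ s, 0 < c * ((∏ k ∈ t, (X - C (y k))).eval (x j) *
      (∏ k ∈ t \ u, (X - C (y k))).eval (x j)) := by
    intro j hj
    rw [← prod_sdiff hut, eval_mul]
    simp only [eval_prod, eval_sub, eval_X, eval_C]
    have h1 : ∏ k ∈ t \ u, (x j - y k) ≠ 0 := prod_ne_zero_iff.2 fun k hk =>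
      sub_ne_zero.2 (hxy j hj k (mem_sdiff.1 hk).1)
    have := mul_pos (hpos j hj) (mul_self_pos.2 h1)
    nlinarith [this]
  obtain ⟨j, hj, hwj⟩ := exists_lt_of_sum_lt (s := s) (f := fun _ => (0 : ℝ)) (g := w) (by simpa)
  have hsum : 0 < ∑ j ∈ s, w j * (c * ((∏ k ∈ t, (X - C (y k))).eval (x j) *
      (∏ k ∈ t \ u, (X - C (y k))).eval (x j))) :=
    sum_pos' (fun i hi => mul_nonneg (hw i hi) (hpos' i hi).le) ⟨j, hj, mul_pos hwj (hpos' j hj)⟩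
  simp only [mul_left_comm _ c] at hsum
  rw [← mul_sum, h, mul_zero] at hsum
  exact lt_irrefl _ hsum

theorem strictlyInterlacesR_of_exists_between {m n : ℕ} {x y : ℕ → ℝ}
    (hx : ∀ j j', 1 ≤ j → j < j' → j' ≤ n → x j < x j')
    (hxy : ∀ j k, 1 ≤ j → j ≤ n → 1 ≤ k → k ≤ m → x j ≠ y k)
    (h : ∀ k ≤ m, ∃ j, 1 ≤ j ∧ j ≤ n ∧ (1 ≤ k → y k < x j) ∧ (k < m → x j < y (k + 1))) :
    StrictlyInterlacesR n m x y := by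
  have hlt : ∀ a b, 1 ≤ a → a ≤ n → 1 ≤ b → b ≤ n → x a < x b → a < b := by
    intro a b ha han hb hbn hab
    rcases lt_trichotomy a b with h | h | h
    · exact h
    · subst h
      exact absurd hab (lt_irrefl _)
    · exact absurd (hx b a hb h han) hab.not_gt
  let g : ℕ → ℕ := fun k => Nat.findGreatest (fun j => 1 ≤ j ∧ x j < y k) n
  have hgle : ∀ k, g k ≤ n := fun k => Nat.findGreatest_le n
  have hge : ∀ k j, 1 ≤ j → j ≤ n → x j < y k → j ≤ g k := fun k j h1 h2 h3 =>
    Nat.le_findGreatest h2 ⟨h1, h3⟩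
  have hspec : ∀ k, 1 ≤ k → k ≤ m → 1 ≤ g k ∧ x (g k) < y k := by
    intro k hk hkm
    obtain ⟨j, hj, hjn, -, hjk⟩ := h (k - 1) (by omega)
    have := hjk (by omega)
    rw [Nat.sub_add_cancel hk] at this
    exact Nat.findGreatest_spec (P := fun j => 1 ≤ j ∧ x j < y k) hjn ⟨hj, this⟩
  have hltj : ∀ k j, 1 ≤ k → k ≤ m → 1 ≤ j → j ≤ n → y k < x j → g k < j := by
    intro k j hk hkm hj hjn hkj
    obtain ⟨h1, h2⟩ := hspec k hk hkm
    exact hlt _ _ h1 (hgle k) hj hjn (h2.trans hkj)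
  refine ⟨fun k => if k = 0 then 0 else if k ≤ m then g k else n, by simp, by simp, ?_, ?_⟩
  · intro r hr
    obtain ⟨j, hj, hjn, h1, h2⟩ := h r hr
    have ha : (if r = 0 then 0 else if r ≤ m then g r else n) < j := by
      by_cases hr0 : r = 0
      · simp only [hr0, if_true]
        omega
      · simp only [hr0, hr, if_true, if_false]
        exact hltj r j (by omega) hr hj hjn (h1 (by omega))
    refine lt_of_lt_of_le ha ?_
    by_cases hrm : r + 1 ≤ m
    · simp only [Nat.add_eq_zero_iff, one_ne_zero, and_false, if_false, hrm, if_true]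
      exact hge _ _ hj hjn (h2 hrm)
    · simpa [hrm] using hjn
  · intro k hk hkm
    have hk0 : k ≠ 0 := by omega
    simp only [hk0, hkm, if_true, if_false]
    refine ⟨(hspec k hk hkm).2, ?_⟩
    obtain ⟨j, hj, hjn, h1, -⟩ := h k hkm
    have hgj := hltj k j hk hkm hj hjn (h1 hk)
    refine lt_of_le_of_ne (not_lt.1 fun hlt' => ?_)
      (hxy _ k (by omega) (by omega) hk hkm).symm
    have := hge k (g k + 1) (by omega) (by omega) hlt'
    omega

theorem IsJacobiMatrix.strictlyInterlacesR {m n : ℕ} (hm : 1 ≤ m) (hmn : m < n)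
    {x y : ℕ → ℝ}
    (hx : ∀ j j', 1 ≤ j → j < j' → j' ≤ n → x j < x j')
    (hy : ∀ k k', 1 ≤ k → k < k' → k' ≤ m → y k < y k')
    (hxy : ∀ j k, 1 ≤ j → j ≤ n → 1 ≤ k → k ≤ m → x j ≠ y k)
    {A : Matrix (Fin n) (Fin n) ℝ} (hA : IsJacobiMatrix A)
    (hP : A.charpoly = ∏ j ∈ Icc 1 n, (X - C (x j)))
    (hQ : (A.submatrix (Fin.castLE hmn.le) (Fin.castLE hmn.le)).charpoly
        = ∏ k ∈ Icc 1 m, (X - C (y k))) : StrictlyInterlacesR n m x y := by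
  have hinj : Set.InjOn x (Icc 1 n : Finset ℕ) := by
    intro a ha b hb hab
    rw [mem_coe, mem_Icc] at ha hb
    rcases lt_trichotomy a b with h | h | h
    · exact absurd hab (hx a b ha.1 h hb.2).ne
    · exact h
    · exact absurd hab (hx b a hb.1 h ha.2).ne'
  obtain ⟨w, hw, hw', horth⟩ := hA.exists_weights hm hmn.le hinj hP
  rw [hQ] at horth
  have hne : ∀ j ∈ Icc 1 n, ∀ k ∈ Icc 1 m, x j ≠ y k := fun j hj k hk =>
    hxy j k (mem_Icc.1 hj).1 (mem_Icc.1 hj).2 (mem_Icc.1 hk).1 (mem_Icc.1 hk).2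
  have key := fun (u : Finset ℕ) (hut : u ⊆ Icc 1 m) (hu : u.Nonempty) =>
    not_forall_pos_of_orthogonal hw hw' hne hut hu (by simpa using horth)
  refine strictlyInterlacesR_of_exists_between hx hxy fun k hk => ?_
  by_contra! hcon
  rcases Nat.eq_zero_or_pos k with rfl | hk1
  · refine key {1} (by simpa using hm) (by simp) 1 fun j hj => ?_
    have hj' := mem_Icc.1 hj
    have h := (hcon j hj'.1 hj'.2 (by simp)).2
    simp only [zero_add] at h
    have := lt_of_le_of_ne h (hne j hj 1 (by simpa using hm)).symm
    simpa using this
  rcases hk.eq_or_lt with rfl | hkm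
  · refine key {k} (by simpa using hm) (by simp) (-1) fun j hj => ?_
    have hj' := mem_Icc.1 hj
    have : x j < y k := by
      refine lt_of_le_of_ne (not_lt.1 fun h => ?_) (hne j hj k (by simpa using hm))
      exact lt_irrefl _ (hcon j hj'.1 hj'.2 fun _ => h).1
    simpa using this
  · have hk2 : k ∈ Icc 1 m := mem_Icc.2 ⟨hk1, hk⟩
    have hk3 : k + 1 ∈ Icc 1 m := mem_Icc.2 ⟨by omega, hkm⟩
    refine key {k, k + 1} (by simp only [insert_subset_iff, singleton_subset_iff, hk2, hk3,
      and_self]) (by simp) 1 fun j hj => ?_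
    have hj' := mem_Icc.1 hj
    rw [prod_pair (by omega), one_mul]
    have hyy := hy k (k + 1) hk1 (by omega) hkm
    rcases lt_or_gt_of_ne (hne j hj k hk2) with h | h
    · exact mul_pos_of_neg_of_neg (by linarith) (by linarith)
    · have h' := lt_of_le_of_ne (hcon j hj'.1 hj'.2 fun _ => h).2 (hne j hj _ hk3).symm
      exact mul_pos (by linarith) (by linarith)

/-- The monic orthogonal polynomials of a linear functional, built by the Stieltjes procedure. -/
noncomputable def stieltjesPoly (L : ℝ[X] →ₗ[ℝ] ℝ) : ℕ → ℝ[X]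
  | 0 => 1
  | 1 => X - C (L X / L 1)
  | k + 2 =>
    (X - C (L (X * stieltjesPoly L (k + 1) * stieltjesPoly L (k + 1)) /
        L (stieltjesPoly L (k + 1) * stieltjesPoly L (k + 1)))) * stieltjesPoly L (k + 1) -
      C (L (stieltjesPoly L (k + 1) * stieltjesPoly L (k + 1)) /
        L (stieltjesPoly L k * stieltjesPoly L k)) * stieltjesPoly L k

theorem stieltjesPoly_monic_natDegree (L : ℝ[X] →ₗ[ℝ] ℝ) (k : ℕ) :
    ((stieltjesPoly L k).Monic ∧ (stieltjesPoly L k).natDegree = k) ∧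
    ((stieltjesPoly L (k + 1)).Monic ∧ (stieltjesPoly L (k + 1)).natDegree = k + 1) := by
  induction k with
  | zero =>
    simp only [stieltjesPoly]
    exact ⟨⟨monic_one, natDegree_one⟩, monic_X_sub_C _, natDegree_X_sub_C _⟩
  | succ k ih =>
    obtain ⟨⟨h1, h2⟩, h3, h4⟩ := ih
    refine ⟨⟨h3, h4⟩, ?_⟩
    rw [stieltjesPoly]
    set β := L (X * stieltjesPoly L (k + 1) * stieltjesPoly L (k + 1)) /
        L (stieltjesPoly L (k + 1) * stieltjesPoly L (k + 1))
    set γ := L (stieltjesPoly L (k + 1) * stieltjesPoly L (k + 1)) /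
        L (stieltjesPoly L k * stieltjesPoly L k)
    have hmon : ((X - C β) * stieltjesPoly L (k + 1)).Monic := (monic_X_sub_C β).mul h3
    have hnd : ((X - C β) * stieltjesPoly L (k + 1)).natDegree = k + 2 := by
      rw [(monic_X_sub_C β).natDegree_mul h3, natDegree_X_sub_C, h4]
      omega
    have hlt : (C γ * stieltjesPoly L k).degree < ((X - C β) * stieltjesPoly L (k + 1)).degree := by
      refine lt_of_le_of_lt degree_le_natDegree ?_
      rw [degree_eq_natDegree hmon.ne_zero, hnd]
      have hle : (C γ * stieltjesPoly L k).natDegree ≤ k := (natDegree_C_mul_le γ _).trans_eq h2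
      exact_mod_cast (by omega : (C γ * stieltjesPoly L k).natDegree < k + 2)
    exact ⟨hmon.sub_of_left hlt,
      (natDegree_eq_of_degree_eq (degree_sub_eq_left_of_degree_lt hlt)).trans hnd⟩

theorem stieltjesPoly_monic (L : ℝ[X] →ₗ[ℝ] ℝ) (k : ℕ) : (stieltjesPoly L k).Monic :=
  (stieltjesPoly_monic_natDegree L k).1.1

theorem stieltjesPoly_natDegree (L : ℝ[X] →ₗ[ℝ] ℝ) (k : ℕ) : (stieltjesPoly L k).natDegree = k :=
  (stieltjesPoly_monic_natDegree L k).1.2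

theorem stieltjesPoly_degree (L : ℝ[X] →ₗ[ℝ] ℝ) (k : ℕ) : (stieltjesPoly L k).degree = k := by
  rw [degree_eq_natDegree (stieltjesPoly_monic L k).ne_zero, stieltjesPoly_natDegree]

theorem Polynomial.exists_eq_C_mul_add_of_degree_lt {p f : ℝ[X]} {k : ℕ} (hp : p.Monic)
    (hpk : p.natDegree = k) (hf : f.degree < (k + 1 : ℕ)) :
    ∃ (a : ℝ) (g : ℝ[X]), g.degree < k ∧ f = C a * p + g := by
  refine ⟨f.coeff k, f - C (f.coeff k) * p, ?_, by ring⟩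
  rw [degree_lt_iff_coeff_zero]
  intro i hi
  rw [coeff_sub, coeff_C_mul]
  rcases hi.eq_or_lt with rfl | hi
  · have : p.coeff k = 1 := by rw [← hpk]; exact hp
    rw [this, mul_one, sub_self]
  · rw [(degree_lt_iff_coeff_zero f (k + 1)).1 hf i hi,
      coeff_eq_zero_of_natDegree_lt (by omega : p.natDegree < i), mul_zero, sub_zero]

theorem Polynomial.Monic.degree_sub_lt_of_natDegree {p q : ℝ[X]} {k : ℕ} (hp : p.Monic)
    (hpk : p.natDegree = k) (hq : q.Monic) (hqk : q.natDegree = k) : (p - q).degree < k := by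
  have hpd : p.degree = k := by rw [degree_eq_natDegree hp.ne_zero, hpk]
  have hqd : q.degree = k := by rw [degree_eq_natDegree hq.ne_zero, hqk]
  rw [← hpd]
  exact degree_sub_lt_left (hpd.trans hqd.symm) hp.ne_zero
    (by rw [hp.leadingCoeff, hq.leadingCoeff])

theorem stieltjesPoly_self_pos {L : ℝ[X] →ₗ[ℝ] ℝ} {n : ℕ}
    (hL : ∀ f : ℝ[X], f ≠ 0 → f.degree < n → 0 < L (f * f)) {k : ℕ} (hk : k < n) :
    0 < L (stieltjesPoly L k * stieltjesPoly L k) :=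
  hL _ (stieltjesPoly_monic L k).ne_zero (by
    rw [stieltjesPoly_degree]
    exact_mod_cast hk)

theorem stieltjesPoly_orthogonal {L : ℝ[X] →ₗ[ℝ] ℝ} {n : ℕ}
    (hL : ∀ f : ℝ[X], f ≠ 0 → f.degree < n → 0 < L (f * f)) (k : ℕ) (hk : k ≤ n)
    (f : ℝ[X]) (hf : f.degree < k) : L (stieltjesPoly L k * f) = 0 := by
  have hCL : ∀ (a : ℝ) (g : ℝ[X]), L (C a * g) = a * L g := fun a g => by
    rw [← smul_eq_C_mul, map_smul, smul_eq_mul]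
  suffices h : ∀ k, (k ≤ n → ∀ f : ℝ[X], f.degree < k → L (stieltjesPoly L k * f) = 0) ∧
      (k + 1 ≤ n → ∀ f : ℝ[X], f.degree < (k + 1 : ℕ) → L (stieltjesPoly L (k + 1) * f) = 0) from
    (h k).1 hk f hf
  intro k
  induction k with
  | zero =>
    refine ⟨fun _ f hf => ?_, fun hn f hf => ?_⟩
    · have : f = 0 := by
        ext i
        simpa using (degree_lt_iff_coeff_zero f 0).1 hf i (Nat.zero_le i)
      simp [this]
    · obtain ⟨a, g, hg, rfl⟩ := exists_eq_C_mul_add_of_degree_lt (p := 1) (k := 0) monic_one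
        natDegree_one hf
      have hg0 : g = 0 := by
        ext i
        simpa using (degree_lt_iff_coeff_zero g 0).1 hg i (Nat.zero_le i)
      have h1 : L 1 ≠ 0 := by
        have := hL 1 one_ne_zero (by
          rw [degree_one]
          exact_mod_cast hn)
        rw [one_mul] at this
        exact this.ne'
      have hexp : stieltjesPoly L (0 + 1) * (C a * 1 + g) = C a * (X - C (L X / L 1) * 1) := by
        rw [hg0, zero_add, stieltjesPoly]
        ring
      rw [hexp, hCL, map_sub, hCL, div_mul_cancel₀ _ h1, sub_self, mul_zero]
  | succ k ih =>
    refine ⟨ih.2, fun hn f hf => ?_⟩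
    have ihk := ih.1 (by omega)
    have ihk1 := ih.2 (by omega)
    have hmk := stieltjesPoly_monic L k
    have hdk := stieltjesPoly_natDegree L k
    have hmk1 := stieltjesPoly_monic L (k + 1)
    have hdk1 := stieltjesPoly_natDegree L (k + 1)
    have hpos := (stieltjesPoly_self_pos hL (by omega : k < n)).ne'
    have hpos1 := (stieltjesPoly_self_pos hL (by omega : k + 1 < n)).ne'
    have hXdeg : ∀ (g : ℝ[X]) (i : ℕ), g.degree < i →
        (X * g).degree < ((i + 1 : ℕ) : WithBot ℕ) := by
      intro g i hg
      rw [degree_lt_iff_coeff_zero] at hg ⊢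
      intro j hj
      obtain ⟨l, rfl⟩ : ∃ l, j = l + 1 := ⟨j - 1, by omega⟩
      rw [coeff_X_mul]
      exact hg l (by omega)
    have hdegp : (stieltjesPoly L k).degree < (k + 1 : ℕ) := by
      rw [stieltjesPoly_degree]
      exact_mod_cast Nat.lt_succ_self k
    obtain ⟨r, hr, hXp⟩ : ∃ r : ℝ[X], r.degree < (k + 1 : ℕ) ∧
        X * stieltjesPoly L k = stieltjesPoly L (k + 1) + r :=
      ⟨X * stieltjesPoly L k - stieltjesPoly L (k + 1),
        (monic_X.mul hmk).degree_sub_lt_of_natDegree (by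
          rw [monic_X.natDegree_mul hmk, natDegree_X, hdk, add_comm]) hmk1 hdk1, by ring⟩
    obtain ⟨a, f', hf', rfl⟩ := exists_eq_C_mul_add_of_degree_lt hmk1 hdk1 hf
    obtain ⟨b, g, hg, rfl⟩ := exists_eq_C_mul_add_of_degree_lt hmk hdk hf'
    rw [stieltjesPoly]
    set p := stieltjesPoly L (k + 1)
    set q := stieltjesPoly L k
    have hexp : ((X - C (L (X * p * p) / L (p * p))) * p - C (L (p * p) / L (q * q)) * q) *
        (C a * p + (C b * q + g)) =
        C a * (X * p * p - C (L (X * p * p) / L (p * p)) * (p * p)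
          - C (L (p * p) / L (q * q)) * (p * q))
        + C b * (p * p + p * r - C (L (X * p * p) / L (p * p)) * (p * q)
          - C (L (p * p) / L (q * q)) * (q * q))
        + (p * (X * g) - C (L (X * p * p) / L (p * p)) * (p * g)
          - C (L (p * p) / L (q * q)) * (q * g)) := by
      linear_combination C b * p * hXp
    have hg1 : g.degree < (k + 1 : ℕ) :=
      hg.trans (by exact_mod_cast Nat.lt_succ_self k)
    rw [hexp]
    simp only [map_add, map_sub, hCL, ihk1 q hdegp, ihk1 r hr, ihk1 _ (hXdeg g k hg), ihk1 g hg1,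
      ihk g hg, div_mul_cancel₀ _ hpos, div_mul_cancel₀ _ hpos1]
    ring

theorem stieltjesPoly_eq_of_orthogonal {L : ℝ[X] →ₗ[ℝ] ℝ} {n : ℕ}
    (hL : ∀ f : ℝ[X], f ≠ 0 → f.degree < n → 0 < L (f * f)) {k : ℕ} (hk : k ≤ n) {q : ℝ[X]}
    (hq : q.Monic) (hqk : q.natDegree = k) (horth : ∀ f : ℝ[X], f.degree < k → L (q * f) = 0) :
    stieltjesPoly L k = q := by
  have hdeg := (stieltjesPoly_monic L k).degree_sub_lt_of_natDegree
    (stieltjesPoly_natDegree L k) hq hqk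
  by_contra hne
  have hpos := hL _ (sub_ne_zero.2 hne) (hdeg.trans_le (by exact_mod_cast hk))
  rw [sub_mul, map_sub, stieltjesPoly_orthogonal hL k hk _ hdeg, horth _ hdeg, sub_zero] at hpos
  exact lt_irrefl _ hpos

/-- The tridiagonal matrix of order `n` with diagonal `b`, subdiagonal `c` and superdiagonal `1`. -/
def jacobiMatrix (b c : ℕ → ℝ) (n : ℕ) : Matrix (Fin n) (Fin n) ℝ := Matrix.of fun p q =>
  if (q : ℕ) = p + 1 then 1 else if (q : ℕ) = p then b p else
    if (p : ℕ) = q + 1 then c p else 0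

theorem isJacobiMatrix_jacobiMatrix {b c : ℕ → ℝ} {n : ℕ} (hc : ∀ k, 1 ≤ k → k < n → 0 < c k) :
    IsJacobiMatrix (jacobiMatrix b c n) := by
  refine ⟨fun p q h => ?_, fun p q h => ?_, fun p q h => ?_⟩
  · simp [jacobiMatrix, Matrix.of_apply, h]
  · have h1 : ¬ (q : ℕ) = p + 1 := by omega
    have h2 : ¬ (q : ℕ) = p := by omega
    simp only [jacobiMatrix, Matrix.of_apply, if_neg h1, if_neg h2, if_pos h]
    exact hc _ (by omega) p.2
  · have h1 : ¬ (q : ℕ) = p + 1 := by omega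
    have h2 : ¬ (q : ℕ) = p := by omega
    have h3 : ¬ (p : ℕ) = q + 1 := by omega
    simp only [jacobiMatrix, Matrix.of_apply, if_neg h1, if_neg h2, if_neg h3]

theorem sum_jacobiMatrix_mul (b c g : ℕ → ℝ) (n : ℕ) (p : Fin n) :
    ∑ q, jacobiMatrix b c n p q * g q =
      (if (p : ℕ) + 1 < n then g (p + 1) else 0) + b p * g p +
        (if 1 ≤ (p : ℕ) then c p * g (p - 1) else 0) := by
  simp only [jacobiMatrix, Matrix.of_apply]
  rw [Fin.sum_univ_eq_sum_range (fun q => (if q = (p : ℕ) + 1 then 1 else if q = (p : ℕ) then b p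
    else if (p : ℕ) = q + 1 then c p else 0) * g q) n]
  have hsplit : ∀ q, (if q = (p : ℕ) + 1 then (1 : ℝ) else if q = (p : ℕ) then b p
      else if (p : ℕ) = q + 1 then c p else 0) * g q =
      (if q = (p : ℕ) + 1 then g q else 0) + (if q = (p : ℕ) then b p * g q else 0) +
        (if 1 ≤ (p : ℕ) then (if q = (p : ℕ) - 1 then c p * g q else 0) else 0) := by
    intro q
    split_ifs <;> first | omega | ring
  simp only [hsplit, sum_add_distrib]
  have h1 : (p : ℕ) < n := p.2
  have h2 : (p : ℕ) - 1 < n := by omega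
  by_cases h : 1 ≤ (p : ℕ)
  · simp [h, h2]
  · simp [h]

/-- If a sequence of monic polynomials satisfies a three-term recurrence, the Jacobi matrix of
order `n` of its coefficients has as its characteristic polynomial the `n`-th term, provided that
the latter has simple real zeros. -/
theorem charpoly_jacobiMatrix {p : ℕ → ℝ[X]} {b c : ℕ → ℝ} (hmon : ∀ k, (p k).Monic)
    (hdeg : ∀ k, (p k).natDegree = k) (h0 : X * p 0 = p 1 + C (b 0) * p 0)
    (hrec : ∀ k, X * p (k + 1) = p (k + 2) + C (b (k + 1)) * p (k + 1) + C (c (k + 1)) * p k)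
    {n : ℕ} {z : Fin n → ℝ} (hz : Function.Injective z) (hroot : ∀ j, (p n).eval (z j) = 0) :
    (jacobiMatrix b c n).charpoly = ∏ j, (X - C (z j)) := by
  set V : Matrix (Fin n) (Fin n) ℝ :=
    (Matrix.of fun i j : Fin n => (p j).eval (z i)).transpose with hV
  have hdet : V.det ≠ 0 := by
    rw [hV, Matrix.det_transpose, ← Matrix.det_eval_matrixOfPolynomials_eq_det_vandermonde z
      (fun j => p j) (fun j => hdeg j) (fun j => hmon j)]
    exact Matrix.det_vandermonde_ne_zero_iff.2 hz
  have hunit : IsUnit V := (Matrix.isUnit_iff_isUnit_det V).2 hdet.isUnit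
  have hcomm : jacobiMatrix b c n * V = V * Matrix.diagonal z := by
    ext k j
    rw [Matrix.mul_apply, Matrix.mul_diagonal]
    simp only [hV, Matrix.transpose_apply, Matrix.of_apply]
    rw [sum_jacobiMatrix_mul b c (fun q => (p q).eval (z j))]
    have hlast : (if (k : ℕ) + 1 < n then (p (k + 1)).eval (z j) else 0) =
        (p (k + 1)).eval (z j) := by
      split_ifs with h
      · rfl
      · rw [show (k : ℕ) + 1 = n by omega, hroot]
    rw [hlast]
    obtain ⟨k, hk⟩ := k
    rcases k with _ | k
    · have := congrArg (eval (z j)) h0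
      simp only [eval_mul, eval_add, eval_X, eval_C] at this
      simp
      linarith
    · have := congrArg (eval (z j)) (hrec k)
      simp only [eval_mul, eval_add, eval_X, eval_C] at this
      simp
      linarith
  have hconj := Matrix.charpoly_units_conj hunit.unit (Matrix.diagonal z)
  rw [← Matrix.charpoly_diagonal, ← hconj, IsUnit.unit_spec, ← hcomm, mul_assoc]
  rw [Matrix.mul_nonsing_inv _ hdet.isUnit, mul_one]

theorem prod_erase_mul_prod_pos_of_interlacing {m : ℕ} {t y : ℕ → ℝ}
    (ht : ∀ i j, i < j → j ≤ m → t i < y (i + 1) ∧ y (i + 1) < t j ∧ t i < y j ∧ y j < t j)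
    {k : ℕ} (hk : k ≤ m) :
    0 < (∏ i ∈ (range (m + 1)).erase k, (t k - t i)) * ∏ l ∈ Icc 1 m, (t k - y l) := by
  have h : ∏ l ∈ Icc 1 m, (t k - y l) =
      ∏ i ∈ (range (m + 1)).erase k, (t k - y (if i < k then i + 1 else i)) := by
    symm
    refine prod_bij' (fun i _ => if i < k then i + 1 else i) (fun l _ => if l ≤ k then l - 1 else l)
      ?_ ?_ ?_ ?_ ?_
    · intro i hi
      simp only [mem_erase, mem_range, mem_Icc] at hi ⊢
      split_ifs <;> omega
    · intro i hi
      simp only [mem_erase, mem_range, mem_Icc] at hi ⊢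
      split_ifs <;> omega
    · intro i hi
      simp only [mem_erase, mem_range] at hi
      grind
    · intro i hi
      simp only [mem_Icc] at hi
      grind
    · intro i _
      rfl
  rw [h, ← prod_mul_distrib]
  refine prod_pos fun i hi => ?_
  simp only [mem_erase, mem_range] at hi
  rcases lt_or_gt_of_ne hi.1 with hik | hik
  · obtain ⟨h1, h2, -, -⟩ := ht i k hik hk
    rw [if_pos hik]
    exact mul_pos (by linarith) (by linarith)
  · obtain ⟨-, -, h1, h2⟩ := ht k i hik (by omega)
    rw [if_neg (by omega)]
    exact mul_pos_of_neg_of_neg (by linarith) (by linarith)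

/-- If `m + 1` points interlace the `m` zeros `y`, then there are positive weights at these points
making `∏ (X - y k)` orthogonal to all polynomials of degree `< m`. -/
theorem exists_pos_weights_of_interlacing {m : ℕ} {t y : ℕ → ℝ}
    (ht : ∀ i j, i < j → j ≤ m → t i < y (i + 1) ∧ y (i + 1) < t j ∧ t i < y j ∧ y j < t j) :
    ∃ W : ℕ → ℝ, (∀ k ≤ m, 0 < W k) ∧ ∀ f : ℝ[X], f.degree < m →
      ∑ k ∈ range (m + 1), W k * ((∏ l ∈ Icc 1 m, (t k - y l)) * f.eval (t k)) = 0 := by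
  have htlt : ∀ i j, i < j → j ≤ m → t i < t j := fun i j hij hj =>
    (ht i j hij hj).1.trans (ht i j hij hj).2.1
  have hinj : Set.InjOn t (range (m + 1) : Finset ℕ) := by
    intro a ha b hb hab
    rw [mem_coe, mem_range] at ha hb
    rcases lt_trichotomy a b with h | h | h
    · exact absurd hab (htlt a b h (by omega)).ne
    · exact h
    · exact absurd hab (htlt b a h (by omega)).ne'
  have hpos := fun k (hk : k ≤ m) => prod_erase_mul_prod_pos_of_interlacing ht hk
  refine ⟨fun k => ((∏ i ∈ (range (m + 1)).erase k, (t k - t i)) *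
    ∏ l ∈ Icc 1 m, (t k - y l))⁻¹, fun k hk => inv_pos.2 (hpos k hk), fun f hf => ?_⟩
  have h := Lagrange.coeff_eq_sum hinj (P := f) (by
    rw [card_range]
    exact hf.trans (by exact_mod_cast Nat.lt_succ_self m))
  rw [card_range, Nat.add_sub_cancel, (degree_lt_iff_coeff_zero f m).1 hf m le_rfl] at h
  rw [h]
  refine sum_congr rfl fun k hk => ?_
  have hk' := (hpos k (by have := mem_range.1 hk; omega)).ne'
  have h1 := left_ne_zero_of_mul hk'
  have h2 := right_ne_zero_of_mul hk'
  field_simp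

theorem StrictlyInterlacesR.exists_weights {m n : ℕ} {x y : ℕ → ℝ}
    (hx : ∀ j j', 1 ≤ j → j < j' → j' ≤ n → x j < x j')
    (hy : ∀ k k', 1 ≤ k → k < k' → k' ≤ m → y k < y k') (h : StrictlyInterlacesR n m x y) :
    ∃ w : ℕ → ℝ, (∀ j ∈ Icc 1 n, 0 < w j) ∧ ∀ f : ℝ[X], f.degree < m →
      ∑ j ∈ Icc 1 n, w j * ((∏ l ∈ Icc 1 m, (x j - y l)) * f.eval (x j)) = 0 := by
  obtain ⟨i, hi0, hin, hilt, hi⟩ := h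
  have himono : ∀ a b, a ≤ b → b ≤ m + 1 → i a ≤ i b := by
    intro a b hab
    induction b, hab using Nat.le_induction with
    | base => exact fun _ => le_rfl
    | succ b _ ih => exact fun hb => (ih (by omega)).trans (hilt b (by omega)).le
  have hxle : ∀ a b, 1 ≤ a → a ≤ b → b ≤ n → x a ≤ x b := by
    intro a b ha hab hb
    rcases hab.eq_or_lt with rfl | hab
    · exact le_rfl
    · exact (hx a b ha hab hb).le
  have hyle : ∀ a b, 1 ≤ a → a ≤ b → b ≤ m → y a ≤ y b := by
    intro a b ha hab hb
    rcases hab.eq_or_lt with rfl | hab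
    · exact le_rfl
    · exact (hy a b ha hab hb).le
  have hlocal : ∀ j0 ∈ Icc 1 n, ∃ v : ℕ → ℝ, (∀ j, 0 ≤ v j) ∧ 0 < v j0 ∧
      ∀ f : ℝ[X], f.degree < m →
        ∑ j ∈ Icc 1 n, v j * ((∏ l ∈ Icc 1 m, (x j - y l)) * f.eval (x j)) = 0 := by
    intro j0 hj0
    rw [mem_Icc] at hj0
    obtain ⟨k0, hk0, hk1, hk2⟩ : ∃ k0 ≤ m, i k0 < j0 ∧ j0 ≤ i (k0 + 1) := by
      have hex : ∃ k, j0 ≤ i (k + 1) := ⟨m, by omega⟩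
      refine ⟨Nat.find hex, Nat.find_min' hex (by omega), ?_, Nat.find_spec hex⟩
      rcases hcase : Nat.find hex with _ | k
      · omega
      · have := Nat.find_min hex (by omega : k < Nat.find hex)
        omega
    let u : ℕ → ℕ := fun k => if k = k0 then j0 else i k + 1
    have hu : ∀ k ≤ m, i k + 1 ≤ u k ∧ u k ≤ i (k + 1) := by
      intro k hk
      by_cases hkk : k = k0
      · subst hkk
        simp only [u, if_true]
        exact ⟨hk1, hk2⟩
      · simp only [u, if_neg hkk]
        exact ⟨le_rfl, hilt k hk⟩
    have hun : ∀ k ≤ m, 1 ≤ u k ∧ u k ≤ n := by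
      intro k hk
      have := hu k hk
      have := himono (k + 1) (m + 1) (by omega) le_rfl
      omega
    have hux : ∀ k < m, x (u k) < y (k + 1) := by
      intro k hk
      have h1 := hun k hk.le
      have h2 := himono (k + 1) (m + 1) (by omega) le_rfl
      exact (hxle _ _ h1.1 (hu k hk.le).2 (by omega)).trans_lt (hi (k + 1) (by omega) hk).1
    have huy : ∀ k, 1 ≤ k → k ≤ m → y k < x (u k) := by
      intro k hk hkm
      have h1 := hun k hkm
      exact (hi k hk hkm).2.trans_le (hxle _ _ (by omega) (hu k hkm).1 h1.2)
    obtain ⟨W, hW, horth⟩ := exists_pos_weights_of_interlacing (m := m) (t := fun k => x (u k))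
      (y := y) (by
        intro a b hab hb
        have h1 := hux a (by omega)
        have h2 := hyle (a + 1) b (by omega) hab hb
        have h3 := huy b (by omega) hb
        exact ⟨h1, h2.trans_lt h3, h1.trans_le h2, h3⟩)
    refine ⟨fun j => ∑ k ∈ range (m + 1), if u k = j then W k else 0, fun j => ?_, ?_, ?_⟩
    · refine sum_nonneg fun k hk => ?_
      split_ifs
      · exact (hW k (by have := mem_range.1 hk; omega)).le
      · exact le_rfl
    · refine sum_pos' (fun k hk => ?_) ⟨k0, mem_range.2 (by omega), ?_⟩
      · split_ifs
        · exact (hW k (by have := mem_range.1 hk; omega)).le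
        · exact le_rfl
      · simpa [u] using hW k0 hk0
    · intro f hf
      refine Eq.trans ?_ (horth f hf)
      simp only [sum_mul]
      rw [sum_comm]
      refine sum_congr rfl fun k hk => ?_
      have := hun k (by have := mem_range.1 hk; omega)
      simp only [ite_mul, zero_mul]
      rw [sum_ite_eq, if_pos (mem_Icc.2 this)]
  choose! v hv0 hvpos hvorth using hlocal
  refine ⟨fun j => ∑ j0 ∈ Icc 1 n, v j0 j, fun j hj => ?_, fun f hf => ?_⟩
  · exact sum_pos' (fun j0 hj0 => hv0 j0 hj0 j) ⟨j, hj, hvpos j hj⟩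
  · simp only [sum_mul]
    rw [sum_comm]
    exact sum_eq_zero fun j0 hj0 => hvorth j0 hj0 f hf

theorem prod_Icc_one_eq_prod_fin {M : Type*} [CommMonoid M] (f : ℕ → M) (n : ℕ) :
    ∏ j ∈ Icc 1 n, f j = ∏ j : Fin n, f (j + 1) := by
  rw [Fin.prod_univ_eq_prod_range (fun j => f (j + 1)) n, range_eq_Ico, prod_Ico_add' f 0 n 1,
    zero_add]
  rfl

theorem StrictlyInterlacesR.exists_isJacobiMatrix {m n : ℕ} (hmn : m < n) {x y : ℕ → ℝ}
    (hx : ∀ j j', 1 ≤ j → j < j' → j' ≤ n → x j < x j')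
    (hy : ∀ k k', 1 ≤ k → k < k' → k' ≤ m → y k < y k') (h : StrictlyInterlacesR n m x y) :
    ∃ A : Matrix (Fin n) (Fin n) ℝ, IsJacobiMatrix A ∧
      A.charpoly = ∏ j ∈ Icc 1 n, (X - C (x j)) ∧
      (A.submatrix (Fin.castLE hmn.le) (Fin.castLE hmn.le)).charpoly
        = ∏ k ∈ Icc 1 m, (X - C (y k)) := by
  obtain ⟨w, hw, horth⟩ := h.exists_weights hx hy
  have hinj : ∀ (N : ℕ) (z : ℕ → ℝ), (∀ j j', 1 ≤ j → j < j' → j' ≤ N → z j < z j') →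
      Function.Injective fun j : Fin N => z (j + 1) := by
    intro N z hz
    refine StrictMono.injective fun a b hab => ?_
    exact hz _ _ (by omega) (by simpa using hab) (by omega)
  have hinjx : Set.InjOn x (Icc 1 n : Finset ℕ) := by
    intro a ha b hb hab
    rw [mem_coe, mem_Icc] at ha hb
    have := @hinj n x hx ⟨a - 1, by omega⟩ ⟨b - 1, by omega⟩ (by
      simpa [Nat.sub_add_cancel ha.1, Nat.sub_add_cancel hb.1] using hab)
    rw [Fin.mk.injEq] at this
    omega
  let L : ℝ[X] →ₗ[ℝ] ℝ := ∑ j ∈ Icc 1 n, w j • Polynomial.leval (x j)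
  have hLapp : ∀ f, L f = ∑ j ∈ Icc 1 n, w j * f.eval (x j) := fun f => by
    simp [L, LinearMap.sum_apply]
  have hL : ∀ f : ℝ[X], f ≠ 0 → f.degree < n → 0 < L (f * f) := by
    intro f hf hfn
    rw [hLapp]
    obtain ⟨j, hj, hfj⟩ : ∃ j ∈ Icc 1 n, f.eval (x j) ≠ 0 := by
      by_contra! hcon
      exact hf (Polynomial.eq_zero_of_degree_lt_of_eval_index_eq_zero _ hinjx (by simpa using hfn)
        hcon)
    simp only [eval_mul]
    exact sum_pos' (fun i hi => mul_nonneg (hw i hi).le (mul_self_nonneg _))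
      ⟨j, hj, mul_pos (hw j hj) (mul_self_pos.2 hfj)⟩
  have hPn : stieltjesPoly L n = ∏ j ∈ Icc 1 n, (X - C (x j)) := by
    refine stieltjesPoly_eq_of_orthogonal hL le_rfl (monic_prod_X_sub_C _ _)
      (by rw [natDegree_finsetProd_X_sub_C_eq_card]; simp) fun f _ => ?_
    rw [hLapp]
    refine sum_eq_zero fun j hj => ?_
    rw [eval_mul, eval_prod, prod_eq_zero hj (by simp), zero_mul, mul_zero]
  have hPm : stieltjesPoly L m = ∏ k ∈ Icc 1 m, (X - C (y k)) := by
    refine stieltjesPoly_eq_of_orthogonal hL hmn.le (monic_prod_X_sub_C _ _)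
      (by rw [natDegree_finsetProd_X_sub_C_eq_card]; simp) fun f hf => ?_
    rw [hLapp]
    refine Eq.trans ?_ (horth f hf)
    refine sum_congr rfl fun j _ => ?_
    rw [eval_mul, eval_prod]
    simp
  let p := stieltjesPoly L
  let b : ℕ → ℝ := fun k => L (X * p k * p k) / L (p k * p k)
  let c : ℕ → ℝ := fun k => L (p k * p k) / L (p (k - 1) * p (k - 1))
  have h0 : X * p 0 = p 1 + C (b 0) * p 0 := by
    simp [p, b, stieltjesPoly]
  have hrec : ∀ k, X * p (k + 1) = p (k + 2) + C (b (k + 1)) * p (k + 1) + C (c (k + 1)) * p k := by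
    intro k
    have : p (k + 2) = (X - C (b (k + 1))) * p (k + 1) - C (c (k + 1)) * p k := by
      simp only [p, b, c, Nat.add_sub_cancel]
      rw [stieltjesPoly]
    rw [this]
    ring
  have hc : ∀ k, 1 ≤ k → k < n → 0 < c k := fun k hk hkn =>
    div_pos (stieltjesPoly_self_pos hL hkn) (stieltjesPoly_self_pos hL (by omega))
  have hchar : ∀ (N : ℕ) (z : ℕ → ℝ), (∀ j j', 1 ≤ j → j < j' → j' ≤ N → z j < z j') →
      stieltjesPoly L N = ∏ j ∈ Icc 1 N, (X - C (z j)) →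
      (jacobiMatrix b c N).charpoly = ∏ j ∈ Icc 1 N, (X - C (z j)) := by
    intro N z hz hN
    rw [charpoly_jacobiMatrix (stieltjesPoly_monic L) (stieltjesPoly_natDegree L) h0 hrec
      (hinj N z hz), prod_Icc_one_eq_prod_fin]
    intro j
    rw [hN, eval_prod, prod_eq_zero (mem_Icc.2 ⟨by omega, j.2⟩ : (j : ℕ) + 1 ∈ Icc 1 N) (by simp)]
  refine ⟨jacobiMatrix b c n, isJacobiMatrix_jacobiMatrix hc, hchar n x hx hPn, ?_⟩
  rw [← hchar m y hy hPm]
  rfl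

end

/-- there exists a Jacobi matrix `J_n` with characteristic polynomial
`∏_{j=1}^n (X - x_j)` whose leading principal `m × m` submatrix has characteristic
polynomial `∏_{k=1}^m (X - y_k)` if and only if `{y_k}_{k=1}^m` strictly interlaces
`{x_j}_{j=1}^n`. -/
theorem stmt_9 (m n : ℕ) (hm : 1 ≤ m) (hmn : m < n)
    (x y : ℕ → ℝ)
    (hx : ∀ j j', 1 ≤ j → j < j' → j' ≤ n → x j < x j')
    (hy : ∀ k k', 1 ≤ k → k < k' → k' ≤ m → y k < y k')
    (hxy : ∀ j k, 1 ≤ j → j ≤ n → 1 ≤ k → k ≤ m → x j ≠ y k) :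
    (∃ A : Matrix (Fin n) (Fin n) ℝ, IsJacobiMatrix A ∧
      A.charpoly = ∏ j ∈ Finset.Icc 1 n, (Polynomial.X - Polynomial.C (x j)) ∧
      (A.submatrix (Fin.castLE hmn.le) (Fin.castLE hmn.le)).charpoly
        = ∏ k ∈ Finset.Icc 1 m, (Polynomial.X - Polynomial.C (y k)))
    ↔ StrictlyInterlacesR n m x y := by
  constructor
  · rintro ⟨A, hA, hP, hQ⟩
    exact hA.strictlyInterlacesR hm hmn hx hy hxy hP hQ
  · intro h
    exact h.exists_isJacobiMatrix hmn hx hy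
end
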